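/- For every i with 1 ≤ i ≤ n−1, r* ≤ r_i, and for every j with 2 ≤ j ≤ n, r* ≤ s_j; that is, every candidate solution produced for Case 1.1 or Case 1.2 is feasible, so its candidate radius is at least the optimal radius. -/

import Mathlib

/-- Path distance along `P` between vertices `a` and `b`. -/
noncomputable def dP {X : Type*} [MetricSpace X] (v : ℕ → X) (a b : ℕ) : ℝ :=
  ∑ m ∈ Finset.Ico (min a b) (max a b), dist (v m) (v (m + 1))

/-- Shortest-path distance in the augmented graph `G(i,j)`. -/
noncomputable def dG {X : Type*} [MetricSpace X] (v : ℕ → X) (i j a b : ℕ) : ℝ :=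
  min (dP v a b)
    (min (dP v a i + dist (v i) (v j) + dP v j b)
         (dP v a j + dist (v i) (v j) + dP v i b))

/-- Eccentricity of vertex `c` in `G(i,j)`: `max_{1 ≤ k ≤ n} dG(c,k)`. -/
noncomputable def ecc {X : Type*} [MetricSpace X] (v : ℕ → X) (n i j c : ℕ) : ℝ :=
  sSup ((fun k => dG v i j c k) '' Set.Icc 1 n)

/-- Radius of `G(i,j)`: `min_{1 ≤ c ≤ n} ecc(i,j,c)`. -/
noncomputable def rad {X : Type*} [MetricSpace X] (v : ℕ → X) (n i j : ℕ) : ℝ :=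
  sInf ((fun c => ecc v n i j c) '' Set.Icc 1 n)

/-- Optimal radius: `min_{1 ≤ i ≤ j ≤ n} rad(i,j)`. -/
noncomputable def rstar {X : Type*} [MetricSpace X] (v : ℕ → X) (n : ℕ) : ℝ :=
  sInf {x | ∃ i j : ℕ, 1 ≤ i ∧ i ≤ j ∧ j ≤ n ∧ x = rad v n i j}

/-- `λ_i = min_{i ≤ j ≤ n} max_{i ≤ k ≤ n} dG(i,j)(i,k)`. -/
noncomputable def lam {X : Type*} [MetricSpace X] (v : ℕ → X) (n i : ℕ) : ℝ :=
  sInf ((fun j => sSup ((fun k => dG v i j i k) '' Set.Icc i n)) '' Set.Icc i n)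

/-- `r_i = min_{1 ≤ c ≤ i} max( dP(1,c), dP(c,i) + λ_i )`. -/
noncomputable def rI {X : Type*} [MetricSpace X] (v : ℕ → X) (n i : ℕ) : ℝ :=
  sInf ((fun c => max (dP v 1 c) (dP v c i + lam v n i)) '' Set.Icc 1 i)

/-- `μ_j = min_{1 ≤ i ≤ j} max_{1 ≤ k ≤ j} dG(i,j)(j,k)`. -/
noncomputable def mu {X : Type*} [MetricSpace X] (v : ℕ → X) (n j : ℕ) : ℝ :=
  sInf ((fun i => sSup ((fun k => dG v i j j k) '' Set.Icc 1 j)) '' Set.Icc 1 j)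

/-- `s_j = min_{j ≤ c ≤ n} max( dP(c,n), dP(j,c) + μ_j )`. -/
noncomputable def sJ {X : Type*} [MetricSpace X] (v : ℕ → X) (n j : ℕ) : ℝ :=
  sInf ((fun c => max (dP v c n) (dP v j c + mu v n j)) '' Set.Icc j n)

/-- Prefix length. -/
noncomputable def pfx {X : Type*} [MetricSpace X] (v : ℕ → X) (a : ℕ) : ℝ :=
  ∑ m ∈ Finset.range a, dist (v m) (v (m + 1))

theorem pfx_mono {X : Type*} [MetricSpace X] (v : ℕ → X) : Monotone (pfx v) := by
  apply monotone_nat_of_le_succ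
  intro m
  simp only [pfx, Finset.sum_range_succ]
  linarith [dist_nonneg (x := v m) (y := v (m + 1))]

theorem dP_eq {X : Type*} [MetricSpace X] (v : ℕ → X) (a b : ℕ) :
    dP v a b = |pfx v b - pfx v a| := by
  rcases le_total a b with h | h
  · rw [dP, min_eq_left h, max_eq_right h, Finset.sum_Ico_eq_sub _ h,
      abs_of_nonneg (sub_nonneg.2 (pfx_mono v h))]
    rfl
  · rw [dP, min_eq_right h, max_eq_left h, Finset.sum_Ico_eq_sub _ h, abs_sub_comm,
      abs_of_nonneg (sub_nonneg.2 (pfx_mono v h))]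
    rfl

theorem dP_nonneg {X : Type*} [MetricSpace X] (v : ℕ → X) (a b : ℕ) : 0 ≤ dP v a b := by
  rw [dP_eq]; exact abs_nonneg _

theorem dP_tri {X : Type*} [MetricSpace X] (v : ℕ → X) (a b c : ℕ) :
    dP v a c ≤ dP v a b + dP v b c := by
  simp only [dP_eq]
  have := abs_sub_le (pfx v c) (pfx v b) (pfx v a)
  linarith

theorem dP_symm {X : Type*} [MetricSpace X] (v : ℕ → X) (a b : ℕ) :
    dP v a b = dP v b a := by
  simp only [dP_eq]; exact abs_sub_comm _ _

theorem dP_sub {X : Type*} [MetricSpace X] (v : ℕ → X) {a b c d : ℕ}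
    (h1 : a ≤ b) (h2 : b ≤ c) (h3 : c ≤ d) : dP v b c ≤ dP v a d := by
  have e1 := pfx_mono v h1
  have e2 := pfx_mono v h2
  have e3 := pfx_mono v h3
  rw [dP_eq, dP_eq, abs_of_nonneg (by linarith), abs_of_nonneg (by linarith)]
  linarith

theorem dG_nonneg {X : Type*} [MetricSpace X] (v : ℕ → X) (i j a b : ℕ) :
    0 ≤ dG v i j a b := by
  have := dP_nonneg v
  have hd := dist_nonneg (x := v i) (y := v j)
  refine le_min (this _ _) (le_min ?_ ?_)
  · linarith [this a i, this j b]
  · linarith [this a j, this i b]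

theorem dG_le_dP {X : Type*} [MetricSpace X] (v : ℕ → X) (i j a b : ℕ) :
    dG v i j a b ≤ dP v a b := min_le_left _ _

theorem dG_tri {X : Type*} [MetricSpace X] (v : ℕ → X) (i j a b c : ℕ) :
    dG v i j a c ≤ dP v a b + dG v i j b c := by
  have h1 := dP_tri v a b c
  have h2 := dP_tri v a b i
  have h3 := dP_tri v a b j
  unfold dG
  rw [← min_add_add_left, ← min_add_add_left]
  refine min_le_min h1 (min_le_min ?_ ?_) <;> linarith

theorem rstar_le {X : Type*} [MetricSpace X] (v : ℕ → X) (n i j c : ℕ) (B : ℝ)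
    (hi : 1 ≤ i) (hij : i ≤ j) (hj : j ≤ n) (hc : 1 ≤ c) (hcn : c ≤ n)
    (h : ∀ k, 1 ≤ k → k ≤ n → dG v i j c k ≤ B) : rstar v n ≤ B := by
  have ecc0 : ∀ i j c, 0 ≤ ecc v n i j c := fun i j c => by
    apply Real.sSup_nonneg
    rintro _ ⟨k, _, rfl⟩
    exact dG_nonneg _ _ _ _ _
  have rad0 : ∀ i j, 0 ≤ rad v n i j := fun i j => by
    apply Real.sInf_nonneg
    rintro _ ⟨k, _, rfl⟩
    exact ecc0 _ _ _
  have a1 : rstar v n ≤ rad v n i j := by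
    apply csInf_le
    · refine ⟨0, ?_⟩
      rintro _ ⟨i, j, _, _, _, rfl⟩
      exact rad0 _ _
    · exact ⟨i, j, hi, hij, hj, rfl⟩
  have a2 : rad v n i j ≤ ecc v n i j c := by
    apply csInf_le
    · exact ((Set.finite_Icc 1 n).image _).bddBelow
    · exact ⟨c, ⟨hc, hcn⟩, rfl⟩
  have a3 : ecc v n i j c ≤ B := by
    apply csSup_le
    · exact ⟨_, c, ⟨hc, hcn⟩, rfl⟩
    · rintro _ ⟨k, ⟨h1, h2⟩, rfl⟩
      exact h k h1 h2
  linarith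

theorem lam_spec {f : ℕ → ℕ → ℝ} (a b : ℕ) (hab : a ≤ b) :
    ∃ j, a ≤ j ∧ j ≤ b ∧ ∀ k, a ≤ k → k ≤ b →
      f j k ≤ sInf ((fun j => sSup ((fun k => f j k) '' Set.Icc a b)) '' Set.Icc a b) := by
  have hne : ((fun j => sSup ((fun k => f j k) '' Set.Icc a b)) '' Set.Icc a b).Nonempty :=
    ⟨_, a, ⟨le_rfl, hab⟩, rfl⟩
  obtain ⟨j, ⟨h1, h2⟩, h3⟩ := hne.csInf_mem ((Set.finite_Icc a b).image _)
  refine ⟨j, h1, h2, fun k k1 k2 => ?_⟩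
  rw [← h3]
  exact le_csSup ((Set.finite_Icc a b).image _).bddAbove ⟨k, ⟨k1, k2⟩, rfl⟩

/-- every candidate radius is at least the optimal radius. -/
theorem stmt_3 {X : Type*} [MetricSpace X] (n : ℕ) (hn : 2 ≤ n) (v : ℕ → X)
    (hv : Set.InjOn v (Set.Icc 1 n)) :
    (∀ i : ℕ, 1 ≤ i → i ≤ n - 1 → rstar v n ≤ rI v n i) ∧
    (∀ j : ℕ, 2 ≤ j → j ≤ n → rstar v n ≤ sJ v n j) := by
  constructor
  · intro i hi hin
    obtain ⟨j, hij, hjn, hj⟩ := lam_spec (f := fun j k => dG v i j i k) i n (by omega)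
    change ∀ k, i ≤ k → k ≤ n → dG v i j i k ≤ lam v n i at hj
    have hl : 0 ≤ lam v n i := (dG_nonneg v i j i i).trans (hj i le_rfl (by omega))
    refine le_csInf ((Set.nonempty_Icc.2 (by omega)).image _) ?_
    rintro _ ⟨c, ⟨hc, hci⟩, rfl⟩
    refine rstar_le v n i j c _ hi hij hjn hc (by omega) fun k hk hkn => ?_
    rcases le_total k c with h | h
    · refine (dG_le_dP _ _ _ _ _).trans (le_trans ?_ (le_max_left _ _))
      rw [dP_symm]
      exact dP_sub v hk h le_rfl
    · refine le_trans ?_ (le_max_right _ _)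
      rcases le_total k i with h' | h'
      · linarith [dG_le_dP v i j c k, dP_sub v le_rfl h h']
      · linarith [dG_tri v i j c i k, hj k h' hkn]
  · intro j hj2 hjn
    obtain ⟨i, hi, hij, hi2⟩ := lam_spec (f := fun i k => dG v i j j k) 1 j (by omega)
    change ∀ k, 1 ≤ k → k ≤ j → dG v i j j k ≤ mu v n j at hi2
    have hl : 0 ≤ mu v n j := (dG_nonneg v i j j j).trans (hi2 j (by omega) le_rfl)
    refine le_csInf ((Set.nonempty_Icc.2 (by omega)).image _) ?_
    rintro _ ⟨c, ⟨hc, hcn⟩, rfl⟩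
    refine rstar_le v n i j c _ hi hij hjn (by omega) hcn fun k hk hkn => ?_
    rcases le_total c k with h | h
    · exact (dG_le_dP _ _ _ _ _).trans (le_trans (dP_sub v le_rfl h hkn) (le_max_left _ _))
    · refine le_trans ?_ (le_max_right _ _)
      rw [dP_symm v j c]
      rcases le_total j k with h' | h'
      · have := dP_sub v h' h le_rfl
        rw [dP_symm v k c, dP_symm v j c] at this
        linarith [dG_le_dP v i j c k]
      · linarith [dG_tri v i j c j k, hi2 k hk h']
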